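/- arXiv:2111.15410 — 2 statements merged into one kernel-verified Lean document; each statement's English description precedes it below -/
import Mathlib

section
/- For any subset S ⊆ M_{m,n}(ℝ) ≅ ℝ^{mn}, the lower Minkowski dimension of S with respect to the quasi-metric induced by the r⊗s-quasinorm satisfies: dim_{r⊗s}(S) ≥ (m+n) − (r_1 + s_1)(mn − dim_H S), where dim_H is the Hausdorff dimension with respect to the standard metric. -/
open Filter Topology

/-- Maximal cardinality of a `δ`-separated subset of `S` with respect to a quasi-metric `d`. -/
noncomputable def maxSepCard {α : Type*} (d : α → α → ℝ) (δ : ℝ) (S : Set α) : ℕ :=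
  sSup {N : ℕ | ∃ F : Finset α, ↑F ⊆ S ∧
    (∀ x ∈ F, ∀ y ∈ F, x ≠ y → δ ≤ d x y) ∧ F.card = N}

/-- Lower Minkowski dimension of `S` with respect to a quasi-metric `d`:
`liminf_{δ→0⁺} log N_δ / log(1/δ)` over bounded subsets. -/
noncomputable def lowerMinkDim {α : Type*} (d : α → α → ℝ) (S : Set α) : ℝ :=
  ⨆ B : {B : Set α // B ⊆ S ∧ ∃ C : ℝ, ∀ x ∈ B, ∀ y ∈ B, d x y ≤ C},
    Filter.liminf
      (fun δ : ℝ => Real.log ((maxSepCard d δ B.1 : ℕ) : ℝ) / Real.log (1 / δ))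
      (nhdsWithin 0 (Set.Ioi 0))


section aux

variable {m n : ℕ} {e : Fin m → Fin n → ℝ}
  {d : (Fin m → Fin n → ℝ) → (Fin m → Fin n → ℝ) → ℝ}

lemma aux_card_bound (he2 : ∀ i j, e i j ≤ 2)
    (H : ∀ δ : ℝ, 0 < δ → ∀ x y, d x y < δ ↔ ∀ i j, |x i j - y i j| < δ ^ (e i j))
    (B : Set (Fin m → Fin n → ℝ)) (R : ℝ) (hR : 1 ≤ R)
    (hB : ∀ x ∈ B, ∀ y ∈ B, ∀ i j, |x i j - y i j| ≤ R)
    (δ : ℝ) (hδ : 0 < δ) (hδ1 : δ < 1) (F : Finset (Fin m → Fin n → ℝ)) (hF : ↑F ⊆ B)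
    (hsep : ∀ x ∈ F, ∀ y ∈ F, x ≠ y → δ ≤ d x y) :
    (F.card : ℝ) ≤ ((2 * R + 2) / δ ^ 2) ^ (m * n) := by
  have hδ2 : 0 < δ ^ 2 := by positivity
  have hδ21 : δ ^ 2 < 1 := by nlinarith
  have hone : 1 ≤ (2 * R + 2) / δ ^ 2 := by
    rw [le_div_iff₀ hδ2]; linarith
  rcases F.eq_empty_or_nonempty with rfl | ⟨x0, hx0⟩
  · simp only [Finset.card_empty, Nat.cast_zero]; positivity
  let I : Finset ℤ := Finset.Icc ⌊-R / δ ^ 2⌋ ⌊R / δ ^ 2⌋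
  have hI : (I.card : ℝ) ≤ (2 * R + 2) / δ ^ 2 := by
    have h1 : ⌊-R / δ ^ 2⌋ ≤ ⌊R / δ ^ 2⌋ := by
      apply Int.floor_le_floor
      gcongr
      linarith
    have h2 : ((I.card : ℤ) : ℝ) = ⌊R / δ ^ 2⌋ + 1 - ⌊-R / δ ^ 2⌋ := by
      simp only [I, Int.card_Icc]
      rw [Int.toNat_of_nonneg (by omega)]
      push_cast; ring
    have h3 : (I.card : ℝ) = ⌊R / δ ^ 2⌋ + 1 - ⌊-R / δ ^ 2⌋ := by
      rw [← h2]; simp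
    rw [h3]
    have h4 := Int.floor_le (R / δ ^ 2)
    have h5 := Int.lt_floor_add_one (-R / δ ^ 2)
    have h6 : 2 ≤ 2 / δ ^ 2 := by
      rw [le_div_iff₀ hδ2]; linarith
    have h7 : (2 * R + 2) / δ ^ 2 = R / δ ^ 2 - (-R / δ ^ 2) + 2 / δ ^ 2 := by ring
    linarith
  let P : Finset (Fin m → Fin n → ℤ) := Fintype.piFinset fun _ => Fintype.piFinset fun _ => I
  have hP : P.card = I.card ^ (m * n) := by
    simp only [P, Fintype.card_piFinset, Finset.prod_const, Finset.card_univ, Fintype.card_fin]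
    rw [← pow_mul, mul_comm]
  have hcard : F.card ≤ P.card := by
    apply Finset.card_le_card_of_injOn (fun x i j => ⌊(x i j - x0 i j) / δ ^ 2⌋)
    · intro x hx
      simp only [P, Finset.mem_coe, Fintype.mem_piFinset, I, Finset.mem_Icc]
      intro i j
      have := abs_le.1 (hB x (hF hx) x0 (hF hx0) i j)
      constructor
      · apply Int.floor_le_floor; gcongr; linarith
      · apply Int.floor_le_floor; gcongr; linarith
    · intro x hx y hy hxy
      by_contra hne
      have h1 := hsep x hx y hy hne
      apply not_lt.2 h1
      rw [H δ hδ]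
      intro i j
      have h2 := congrFun (congrFun hxy i) j
      have h3 := Int.abs_sub_lt_one_of_floor_eq_floor h2
      have h4 : (x i j - x0 i j) / δ ^ 2 - (y i j - x0 i j) / δ ^ 2 = (x i j - y i j) / δ ^ 2 := by
        ring
      rw [h4, abs_div, abs_of_pos hδ2, div_lt_one hδ2] at h3
      refine h3.trans_le ?_
      rw [← Real.rpow_natCast]
      exact Real.rpow_le_rpow_of_exponent_ge hδ hδ1.le (by exact_mod_cast he2 i j)
  calc (F.card : ℝ) ≤ P.card := by exact_mod_cast hcard
    _ = (I.card : ℝ) ^ (m * n) := by rw [hP]; push_cast; rfl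
    _ ≤ _ := by gcongr

lemma aux_bdd (he0 : ∀ i j, 0 < e i j) (he2 : ∀ i j, e i j ≤ 2)
    (H : ∀ δ : ℝ, 0 < δ → ∀ x y, d x y < δ ↔ ∀ i j, |x i j - y i j| < δ ^ (e i j))
    (B : Set (Fin m → Fin n → ℝ)) (hB : ∃ C : ℝ, ∀ x ∈ B, ∀ y ∈ B, d x y ≤ C) :
    ∃ R : ℝ, 1 ≤ R ∧ ∀ x ∈ B, ∀ y ∈ B, ∀ i j, |x i j - y i j| ≤ R := by
  obtain ⟨C, hC⟩ := hB
  have h1 : 1 ≤ max C 0 + 1 := by have := le_max_right C 0; linarith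
  refine ⟨(max C 0 + 1) ^ (2 : ℝ), Real.one_le_rpow h1 (by norm_num), fun x hx y hy i j => ?_⟩
  have h2 : d x y < max C 0 + 1 := by
    have := hC x hx y hy
    have := le_max_left C 0
    linarith
  refine ((H _ (by linarith) x y).1 h2 i j).le.trans ?_
  exact Real.rpow_le_rpow_of_exponent_le h1 (he2 i j)

lemma aux_bddAbove (he2 : ∀ i j, e i j ≤ 2)
    (H : ∀ δ : ℝ, 0 < δ → ∀ x y, d x y < δ ↔ ∀ i j, |x i j - y i j| < δ ^ (e i j))
    (B : Set (Fin m → Fin n → ℝ)) (R : ℝ) (hR : 1 ≤ R)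
    (hB : ∀ x ∈ B, ∀ y ∈ B, ∀ i j, |x i j - y i j| ≤ R)
    (δ : ℝ) (hδ : 0 < δ) (hδ1 : δ < 1) :
    ∃ F : Finset (Fin m → Fin n → ℝ), ↑F ⊆ B ∧ (∀ x ∈ F, ∀ y ∈ F, x ≠ y → δ ≤ d x y) ∧
      F.card = maxSepCard d δ B ∧ ∀ y ∈ B, ∃ x ∈ F, d x y < δ := by
  classical
  set T : Set ℕ := {N : ℕ | ∃ F : Finset (Fin m → Fin n → ℝ), ↑F ⊆ B ∧
    (∀ x ∈ F, ∀ y ∈ F, x ≠ y → δ ≤ d x y) ∧ F.card = N} with hT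
  have hne : T.Nonempty := ⟨0, ∅, by simp, by simp, by simp⟩
  have hbdd : BddAbove T := by
    refine ⟨⌊((2 * R + 2) / δ ^ 2) ^ (m * n)⌋₊, ?_⟩
    rintro N ⟨F, h1, h2, rfl⟩
    exact Nat.le_floor (aux_card_bound he2 H B R hR hB δ hδ hδ1 F h1 h2)
  obtain ⟨F, h1, h2, h3⟩ := Nat.sSup_mem hne hbdd
  refine ⟨F, h1, h2, h3, ?_⟩
  intro y hy
  by_contra! hcon
  have hsymm : ∀ x ∈ F, δ ≤ d y x := by
    intro x hx
    by_contra! hlt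
    apply not_lt.2 (hcon x hx)
    rw [H δ hδ] at hlt ⊢
    intro i j
    rw [abs_sub_comm]
    exact hlt i j
  have hyF : y ∉ F := by
    intro hyF
    apply not_lt.2 (hcon y hyF)
    rw [H δ hδ]
    intro i j
    simp only [sub_self, abs_zero]
    positivity
  have hmem : (insert y F).card ∈ T := by
    refine ⟨insert y F, ?_, ?_, rfl⟩
    · intro z hz
      simp only [Finset.coe_insert, Set.mem_insert_iff] at hz
      rcases hz with rfl | hz
      · exact hy
      · exact h1 hz
    · intro a ha b hb hab
      rw [Finset.mem_insert] at ha hb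
      rcases ha with rfl | ha <;> rcases hb with rfl | hb
      · exact absurd rfl hab
      · exact hsymm b hb
      · exact hcon a ha
      · exact h2 a ha b hb hab
  have := le_csSup hbdd hmem
  rw [Finset.card_insert_of_notMem hyF] at this
  omega

lemma aux_log_tendsto : Tendsto (fun δ : ℝ => Real.log (1 / δ)) (𝓝[>] 0) atTop := by
  have : Tendsto (fun δ : ℝ => Real.log (δ⁻¹)) (𝓝[>] 0) atTop :=
    Real.tendsto_log_atTop.comp tendsto_inv_nhdsGT_zero
  simpa using this

lemma aux_small : ∀ᶠ δ : ℝ in 𝓝[>] 0, 0 < δ ∧ δ < 1 := by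
  filter_upwards [Ioo_mem_nhdsGT (zero_lt_one' ℝ)] with δ hδ using hδ

lemma aux_nonneg (B : Set (Fin m → Fin n → ℝ)) : ∀ᶠ δ : ℝ in 𝓝[>] 0,
    0 ≤ Real.log ((maxSepCard d δ B : ℕ) : ℝ) / Real.log (1 / δ) := by
  filter_upwards [aux_small] with δ hδ
  apply div_nonneg (Real.log_natCast_nonneg _)
  apply Real.log_nonneg
  rw [le_div_iff₀ hδ.1]; linarith

lemma aux_upper (he0 : ∀ i j, 0 < e i j) (he2 : ∀ i j, e i j ≤ 2)
    (H : ∀ δ : ℝ, 0 < δ → ∀ x y, d x y < δ ↔ ∀ i j, |x i j - y i j| < δ ^ (e i j))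
    (B : Set (Fin m → Fin n → ℝ)) (hB : ∃ C : ℝ, ∀ x ∈ B, ∀ y ∈ B, d x y ≤ C) :
    ∀ᶠ δ : ℝ in 𝓝[>] 0,
      Real.log ((maxSepCard d δ B : ℕ) : ℝ) / Real.log (1 / δ) ≤ (m * n : ℕ) * 3 := by
  obtain ⟨R, hR, hBR⟩ := aux_bdd he0 he2 H B hB
  filter_upwards [aux_small, aux_log_tendsto.eventually_ge_atTop (Real.log (2 * R + 2)),
    aux_log_tendsto.eventually_gt_atTop 0] with δ hδ hL hL0
  obtain ⟨F, h1, h2, h3, -⟩ := aux_bddAbove he2 H B R hR hBR δ hδ.1 hδ.2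
  rw [div_le_iff₀ hL0, ← h3]
  have hc := aux_card_bound he2 H B R hR hBR δ hδ.1 hδ.2 F h1 h2
  rcases Nat.eq_zero_or_pos F.card with h0 | hpos
  · rw [h0]; simp only [Nat.cast_zero, Real.log_zero]; positivity
  have hlog := Real.log_le_log (by exact_mod_cast hpos) hc
  rw [Real.log_pow, Real.log_div (by positivity) (by have := hδ.1; positivity), Real.log_pow] at hlog
  refine hlog.trans ?_
  rw [mul_assoc]
  gcongr
  have : Real.log (1 / δ) = - Real.log δ := by simp
  rw [this] at hL ⊢
  push_cast
  linarith

lemma aux_main (he0 : ∀ i j, 0 < e i j) (he2 : ∀ i j, e i j ≤ 2) (t : ℝ) (ht0 : 0 < t)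
    (het : ∀ i j, e i j ≤ t)
    (H : ∀ δ : ℝ, 0 < δ → ∀ x y, d x y < δ ↔ ∀ i j, |x i j - y i j| < δ ^ (e i j))
    (B : Set (Fin m → Fin n → ℝ)) (hB : ∃ C : ℝ, ∀ x ∈ B, ∀ y ∈ B, d x y ≤ C)
    (u : NNReal) (hu : (u : ENNReal) < dimH B) :
    ∀ᶠ δ : ℝ in 𝓝[>] 0, 0 < δ ∧ δ < 1 ∧
      1 ≤ (maxSepCard d δ B : ℝ) * (∏ i, ∏ j, 3 * δ ^ (e i j - t)) * δ ^ (t * u) := by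
  obtain ⟨R, hR, hBR⟩ := aux_bdd he0 he2 H B hB
  have hex : ∀ δ : ℝ, ∃ F : Finset (Fin m → Fin n → ℝ), 0 < δ → δ < 1 →
      F.card = maxSepCard d δ B ∧ ∀ y ∈ B, ∃ x ∈ F, d x y < δ := by
    intro δ
    by_cases h : 0 < δ ∧ δ < 1
    · obtain ⟨F, -, -, h3, h4⟩ := aux_bddAbove he2 H B R hR hBR δ h.1 h.2
      exact ⟨F, fun _ _ => ⟨h3, h4⟩⟩
    · exact ⟨∅, fun a b => absurd ⟨a, b⟩ h⟩
  choose F hF using hex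
  borelize (Fin m → Fin n → ℝ)
  have hmeas := hausdorffMeasure_of_lt_dimH hu
  let K : ℝ → Fin m → Fin n → ℕ := fun δ i j => ⌊2 * δ ^ (e i j) / δ ^ t⌋₊ + 1
  let A : (δ : ℝ) → (F δ × (∀ i j, Fin (K δ i j))) → Set (Fin m → Fin n → ℝ) :=
    fun δ q => {y | ∀ i j, y i j ∈ Set.Icc
      (q.1.1 i j - δ ^ (e i j) + (q.2 i j : ℕ) * δ ^ t)
      (q.1.1 i j - δ ^ (e i j) + ((q.2 i j : ℕ) + 1) * δ ^ t)}
  have hr : Tendsto (fun δ : ℝ => ENNReal.ofReal (δ ^ t)) (𝓝[>] 0) (𝓝 0) := by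
    rw [← ENNReal.ofReal_zero]
    apply ENNReal.tendsto_ofReal
    have := (Real.continuousAt_rpow_const 0 t (Or.inr ht0.le)).tendsto
    rw [Real.zero_rpow ht0.ne'] at this
    exact this.mono_left nhdsWithin_le_nhds
  have hdiam : ∀ᶠ δ : ℝ in 𝓝[>] 0, ∀ q, Metric.ediam (A δ q) ≤ ENNReal.ofReal (δ ^ t) := by
    filter_upwards with δ q
    refine Metric.ediam_le fun x hx y hy => ?_
    rw [edist_pi_le_iff]; intro i
    rw [edist_pi_le_iff]; intro j
    rw [edist_dist]
    apply ENNReal.ofReal_le_ofReal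
    refine (Real.dist_le_of_mem_Icc (hx i j) (hy i j)).trans (le_of_eq ?_)
    ring
  have hcov : ∀ᶠ δ : ℝ in 𝓝[>] 0, B ⊆ ⋃ q, A δ q := by
    filter_upwards [aux_small] with δ hδ y hy
    obtain ⟨x, hx, hxy⟩ := (hF δ hδ.1 hδ.2).2 y hy
    rw [H δ hδ.1] at hxy
    have hρ : 0 < δ ^ t := Real.rpow_pos_of_pos hδ.1 t
    have hk : ∀ i j, ⌊(y i j - x i j + δ ^ (e i j)) / δ ^ t⌋₊ < K δ i j := by
      intro i j
      apply Nat.lt_succ_of_le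
      apply Nat.floor_le_floor
      have := abs_lt.1 (hxy i j)
      gcongr
      linarith
    rw [Set.mem_iUnion]
    refine ⟨(⟨x, hx⟩, fun i j => ⟨_, hk i j⟩), fun i j => ?_⟩
    have := abs_lt.1 (hxy i j)
    have h1 := Nat.floor_le (a := (y i j - x i j + δ ^ (e i j)) / δ ^ t)
      (div_nonneg (by linarith) hρ.le)
    have h2 := Nat.lt_floor_add_one ((y i j - x i j + δ ^ (e i j)) / δ ^ t)
    rw [le_div_iff₀ hρ] at h1
    rw [div_lt_iff₀ hρ] at h2
    constructor
    · change x i j - δ ^ (e i j) + _ ≤ _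
      linarith
    · change _ ≤ x i j - δ ^ (e i j) + _
      linarith
  have hlim := MeasureTheory.Measure.hausdorffMeasure_le_liminf_sum (u : ℝ) B
    (fun δ : ℝ => ENNReal.ofReal (δ ^ t)) hr A hdiam hcov
  rw [hmeas] at hlim
  have hev := eventually_lt_of_lt_liminf (lt_of_lt_of_le ENNReal.one_lt_top hlim)
  filter_upwards [aux_small, hdiam, hev] with δ hδ hdi hsum
  refine ⟨hδ.1, hδ.2, ?_⟩
  have hρ : 0 < δ ^ t := Real.rpow_pos_of_pos hδ.1 t
  have h1 : ∑ q, Metric.ediam (A δ q) ^ (u : ℝ) ≤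
      ENNReal.ofReal ((Fintype.card (F δ × (∀ i j, Fin (K δ i j))) : ℝ) * δ ^ (t * u)) := by
    calc ∑ q, Metric.ediam (A δ q) ^ (u : ℝ)
        ≤ ∑ q : (F δ × (∀ i j, Fin (K δ i j))), ENNReal.ofReal (δ ^ (t * u)) := by
          apply Finset.sum_le_sum
          intro q _
          rw [Real.rpow_mul hδ.1.le, ← ENNReal.ofReal_rpow_of_pos hρ]
          exact ENNReal.rpow_le_rpow (hdi q) u.2
      _ = _ := by
          rw [Finset.sum_const, Finset.card_univ, nsmul_eq_mul,
            ENNReal.ofReal_mul (by positivity), ENNReal.ofReal_natCast]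
  have h2 := (hsum.trans_le h1).le
  rw [← ENNReal.ofReal_one] at h2
  have h3 := (ENNReal.ofReal_le_ofReal_iff
    (mul_nonneg (Nat.cast_nonneg _) (Real.rpow_nonneg hδ.1.le _))).1 h2
  refine h3.trans ?_
  apply mul_le_mul_of_nonneg_right _ (Real.rpow_nonneg hδ.1.le _)
  rw [Fintype.card_prod, Fintype.card_coe, (hF δ hδ.1 hδ.2).1]
  simp only [Fintype.card_pi, Fintype.card_fin]
  push_cast
  gcongr with i _ j _
  simp only [K]
  push_cast
  have h4 := Nat.floor_le (a := 2 * δ ^ (e i j) / δ ^ t)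
    (div_nonneg (mul_nonneg (by norm_num) (Real.rpow_nonneg hδ.1.le _)) hρ.le)
  have h5 : 1 ≤ δ ^ (e i j - t) :=
    Real.one_le_rpow_of_pos_of_le_one_of_nonpos hδ.1 hδ.2.le (by linarith [het i j])
  have h6 : 2 * δ ^ (e i j) / δ ^ t = 2 * δ ^ (e i j - t) := by
    rw [Real.rpow_sub hδ.1]; ring
  linarith

lemma aux_lower (he0 : ∀ i j, 0 < e i j) (he2 : ∀ i j, e i j ≤ 2) (t : ℝ) (ht0 : 0 < t)
    (het : ∀ i j, e i j ≤ t)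
    (H : ∀ δ : ℝ, 0 < δ → ∀ x y, d x y < δ ↔ ∀ i j, |x i j - y i j| < δ ^ (e i j))
    (B : Set (Fin m → Fin n → ℝ)) (hB : ∃ C : ℝ, ∀ x ∈ B, ∀ y ∈ B, d x y ≤ C)
    (u : NNReal) (hu : (u : ENNReal) < dimH B) :
    (∑ i, ∑ j, e i j) - t * ((m : ℝ) * n - u) ≤ liminf
      (fun δ : ℝ => Real.log ((maxSepCard d δ B : ℕ) : ℝ) / Real.log (1 / δ)) (𝓝[>] 0) := by
  have hcob : IsCoboundedUnder (· ≥ ·) (𝓝[>] (0 : ℝ))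
      (fun δ : ℝ => Real.log ((maxSepCard d δ B : ℕ) : ℝ) / Real.log (1 / δ)) :=
    IsBoundedUnder.isCoboundedUnder_ge ⟨_, by
      simpa only [eventually_map] using aux_upper he0 he2 H B hB⟩
  apply le_of_forall_pos_le_add
  intro η hη
  rw [← sub_le_iff_le_add]
  apply le_liminf_of_le hcob
  filter_upwards [aux_main he0 he2 t ht0 het H B hB u hu,
    aux_log_tendsto.eventually_gt_atTop 0,
    aux_log_tendsto.eventually_ge_atTop ((m : ℝ) * n * Real.log 3 / η)] with δ hδ hL0 hL
  obtain ⟨hδ0, hδ1, h⟩ := hδ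
  rw [le_div_iff₀ hL0]
  rw [div_le_iff₀ hη] at hL
  have hprod : (∏ i : Fin m, ∏ j : Fin n, 3 * δ ^ (e i j - t)) =
      3 ^ (m * n) * δ ^ ((∑ i, ∑ j, e i j) - t * ((m : ℝ) * n)) := by
    simp only [Finset.prod_mul_distrib, Finset.prod_const, Finset.card_univ, Fintype.card_fin,
      ← Real.rpow_sum_of_pos hδ0]
    rw [← pow_mul, mul_comm n m]
    congr 2
    simp only [Finset.sum_sub_distrib, Finset.sum_const, Finset.card_univ, Fintype.card_fin,
      nsmul_eq_mul]
    ring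
  rw [hprod] at h
  have hN : (maxSepCard d δ B : ℝ) ≠ 0 := by
    intro h0
    rw [h0] at h
    norm_num at h
  have hp1 := (Real.rpow_pos_of_pos hδ0 ((∑ i, ∑ j, e i j) - t * ((m : ℝ) * n))).ne'
  have hp2 := (Real.rpow_pos_of_pos hδ0 (t * u)).ne'
  have hlog := Real.log_le_log one_pos h
  rw [Real.log_one, Real.log_mul (by positivity) hp2, Real.log_mul hN (by positivity),
    Real.log_mul (by positivity) hp1, Real.log_pow, Real.log_rpow hδ0, Real.log_rpow hδ0] at hlog
  have : Real.log (1 / δ) = - Real.log δ := by simp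
  rw [this] at hL ⊢
  push_cast at hlog
  nlinarith

lemma aux_final (he0 : ∀ i j, 0 < e i j) (he2 : ∀ i j, e i j ≤ 2) (t : ℝ) (ht0 : 0 < t)
    (het : ∀ i j, e i j ≤ t)
    (H : ∀ δ : ℝ, 0 < δ → ∀ x y, d x y < δ ↔ ∀ i j, |x i j - y i j| < δ ^ (e i j))
    (S : Set (Fin m → Fin n → ℝ)) :
    (∑ i, ∑ j, e i j) - t * ((m : ℝ) * n - (dimH S).toReal) ≤ lowerMinkDim d S := by
  have hbdd : BddAbove (Set.range fun B : {B : Set (Fin m → Fin n → ℝ) //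
      B ⊆ S ∧ ∃ C : ℝ, ∀ x ∈ B, ∀ y ∈ B, d x y ≤ C} =>
      Filter.liminf
      (fun δ : ℝ => Real.log ((maxSepCard d δ B.1 : ℕ) : ℝ) / Real.log (1 / δ))
      (nhdsWithin 0 (Set.Ioi 0))) := by
    refine ⟨(m * n : ℕ) * 3, ?_⟩
    rintro _ ⟨B, rfl⟩
    refine liminf_le_of_frequently_le (aux_upper he0 he2 H B.1 B.2.2).frequently ?_
    exact ⟨0, by simpa only [eventually_map] using aux_nonneg B.1⟩
  have hle : ∀ B : Set (Fin m → Fin n → ℝ), B ⊆ S → (∃ C : ℝ, ∀ x ∈ B, ∀ y ∈ B, d x y ≤ C) →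
      liminf (fun δ : ℝ => Real.log ((maxSepCard d δ B : ℕ) : ℝ) / Real.log (1 / δ)) (𝓝[>] 0)
        ≤ lowerMinkDim d S := fun B h1 h2 => le_ciSup hbdd ⟨B, h1, h2⟩
  rcases (ENNReal.toReal_nonneg (a := dimH S)).eq_or_lt with h0 | hpos
  · rw [← h0]
    have h1 : (∑ i, ∑ j, e i j) ≤ t * ((m : ℝ) * n) := by
      calc (∑ i, ∑ j, e i j) ≤ ∑ i : Fin m, ∑ j : Fin n, t := by
            gcongr with i _ j _; exact het i j
        _ = _ := by simp; ring
    have hB : ∃ C : ℝ, ∀ x ∈ (∅ : Set (Fin m → Fin n → ℝ)), ∀ y ∈ (∅ : Set (Fin m → Fin n → ℝ)),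
      d x y ≤ C := ⟨0, by simp⟩
    have h2 := hle ∅ (by simp) hB
    have h3 : 0 ≤ liminf (fun δ : ℝ => Real.log ((maxSepCard d δ ∅ : ℕ) : ℝ) / Real.log (1 / δ))
        (𝓝[>] 0) := by
      apply le_liminf_of_le _ (aux_nonneg _)
      exact IsBoundedUnder.isCoboundedUnder_ge ⟨_, by
        simpa only [eventually_map] using aux_upper he0 he2 H ∅ hB⟩
    linarith
  · have key : ∀ u : ℝ, 0 ≤ u → u < (dimH S).toReal →
        (∑ i, ∑ j, e i j) - t * ((m : ℝ) * n - u) ≤ lowerMinkDim d S := by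
      intro u hu0 hu
      lift u to NNReal using hu0
      have hu' : (u : ENNReal) < dimH S := by
        rw [← ENNReal.ofReal_coe_nnreal]
        exact (ENNReal.ofReal_lt_iff_lt_toReal u.2
          (fun h => by simp [h] at hpos)).2 hu
      have hS : S = ⋃ k : ℕ, S ∩ Metric.ball 0 k := by
        rw [← Set.inter_iUnion, Metric.iUnion_ball_nat, Set.inter_univ]
      rw [hS, dimH_iUnion, lt_iSup_iff] at hu'
      obtain ⟨k, hk⟩ := hu'
      have hB : ∃ C : ℝ, ∀ x ∈ S ∩ Metric.ball 0 (k : ℝ), ∀ y ∈ S ∩ Metric.ball 0 (k : ℝ),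
          d x y ≤ C := by
        have hfin : ∃ C : ℝ, 0 < C ∧ ∀ i j, (2 * k : ℝ) ≤ C ^ (e i j) := by
          have h1 : ∀ᶠ C : ℝ in atTop, ∀ i j, (2 * k : ℝ) ≤ C ^ (e i j) := by
            rw [eventually_all]; intro i
            rw [eventually_all]; intro j
            exact (tendsto_rpow_atTop (he0 i j)).eventually_ge_atTop _
          obtain ⟨C, h2, h3⟩ := ((eventually_gt_atTop (0 : ℝ)).and h1).exists
          exact ⟨C, h2, h3⟩
        obtain ⟨C, hC0, hC⟩ := hfin
        refine ⟨C, fun x hx y hy => le_of_lt ?_⟩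
        rw [H C hC0]
        intro i j
        refine lt_of_lt_of_le ?_ (hC i j)
        have h1 := hx.2
        have h2 := hy.2
        rw [mem_ball_zero_iff] at h1 h2
        have h3 : |x i j - y i j| ≤ ‖x - y‖ :=
          (norm_le_pi_norm ((x - y) i) j).trans (norm_le_pi_norm (x - y) i)
        have h4 := norm_sub_le x y
        linarith
      exact (aux_lower he0 he2 t ht0 het H _ hB u hk).trans (hle _ Set.inter_subset_left hB)
    apply le_of_forall_pos_le_add
    intro η hη
    have h1 := key (max 0 ((dimH S).toReal - η / t)) (le_max_left _ _)
      (max_lt hpos (by have := div_pos hη ht0; linarith))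
    have h2 := le_max_right 0 ((dimH S).toReal - η / t)
    have h3 := mul_le_mul_of_nonneg_left h2 ht0.le
    have h4 : t * ((dimH S).toReal - η / t) = t * (dimH S).toReal - η := by field_simp
    linarith

end aux

/-- `dim_{r⊗s}(S) ≥ (m+n) − (r_1+s_1)(mn − dim_H S)` for `S ⊆ M_{m,n}(ℝ)`. -/
theorem lowerMinkDim_rs_ge {m n : ℕ} (hm : 0 < m) (hn : 0 < n)
    (r : Fin m → ℝ) (s : Fin n → ℝ)
    (hrpos : ∀ i, 0 < r i) (hspos : ∀ j, 0 < s j)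
    (hrmono : ∀ i i' : Fin m, i ≤ i' → r i' ≤ r i)
    (hsmono : ∀ j j' : Fin n, j ≤ j' → s j' ≤ s j)
    (hrsum : ∑ i, r i = 1) (hssum : ∑ j, s j = 1)
    (S : Set (Fin m → Fin n → ℝ)) :
    (m + n : ℝ) - (r ⟨0, hm⟩ + s ⟨0, hn⟩) * ((m : ℝ) * n - (dimH S).toReal) ≤
      lowerMinkDim
        (fun A B => Finset.univ.sup'
          (Finset.univ_nonempty_iff.mpr ⟨(⟨0, hm⟩, ⟨0, hn⟩)⟩)
          (fun p : Fin m × Fin n => |A p.1 p.2 - B p.1 p.2| ^ (r p.1 + s p.2)⁻¹)) S := by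
  have hsumr : ∀ i, r i ≤ 1 := fun i => by
    rw [← hrsum]
    exact Finset.single_le_sum (fun i _ => (hrpos i).le) (Finset.mem_univ i)
  have hsums : ∀ j, s j ≤ 1 := fun j => by
    rw [← hssum]
    exact Finset.single_le_sum (fun i _ => (hspos i).le) (Finset.mem_univ j)
  have hE : ∑ i, ∑ j, (r i + s j) = (m + n : ℝ) := by
    simp only [Finset.sum_add_distrib, Finset.sum_const, Finset.card_univ, Fintype.card_fin,
      nsmul_eq_mul, hssum, ← Finset.mul_sum, hrsum]
    ring
  rw [← hE]
  have hpos : ∀ i j, 0 < r i + s j := fun i j => add_pos (hrpos i) (hspos j)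
  refine aux_final (e := fun i j => r i + s j) hpos
    (fun i j => by linarith [hsumr i, hsums j]) _ (hpos _ _)
    (fun i j => add_le_add (hrmono _ _ (Fin.mk_le_of_le_val (Nat.zero_le _)))
      (hsmono _ _ (Fin.mk_le_of_le_val (Nat.zero_le _)))) ?_ S
  intro δ hδ x y
  rw [Finset.sup'_lt_iff]
  constructor
  · intro h i j
    have := h (i, j) (Finset.mem_univ _)
    exact (Real.rpow_inv_lt_iff_of_pos (abs_nonneg _) hδ.le (hpos i j)).1 this
  · intro h p _
    exact (Real.rpow_inv_lt_iff_of_pos (abs_nonneg _) hδ.le (hpos p.1 p.2)).2 (h p.1 p.2)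
end

section
/- Let A ∈ M_{m,n}(ℝ), 0 < ε < 1, d = m+n, c = d^{1/(2(d−1))}. For all sufficiently large T ≥ 1: if there exists a nonzero q ∈ ℤ^n with ⟨Aq⟩_r ≤ ε T^{-1} and ‖q‖_s ≤ T, then there exists a nonzero y ∈ ℤ^m with ⟨A^T y⟩_s ≤ c^{1/r_m + 1/s_n} ε^{r_m s_n/(s_n + r_1(1−s_n))} T_1^{-1} and ‖y‖_r ≤ T_1, where T_1 = c^{1/r_m} ε^{−r_m(1−s_n)/(s_n + r_1(1−s_n))} T. -/
/-- The weighted `w`-quasinorm `‖x‖_w = max_i |x_i|^{1/w_i}` on `ℝ^k`. -/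
noncomputable def qnorm {k : ℕ} (hk : 0 < k) (w : Fin k → ℝ) (x : Fin k → ℝ) : ℝ :=
  Finset.univ.sup' (Finset.univ_nonempty_iff.mpr (Fin.pos_iff_nonempty.mp hk))
    (fun i => |x i| ^ (w i)⁻¹)

/-- `⟨x⟩_w = inf_{p ∈ ℤ^k} ‖x − p‖_w`, the quasinorm distance to the integer lattice. -/
noncomputable def idist {k : ℕ} (hk : 0 < k) (w : Fin k → ℝ) (x : Fin k → ℝ) : ℝ :=
  ⨅ p : Fin k → ℤ, qnorm hk w (fun i => x i - (p i : ℝ))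

section Helpers
open MeasureTheory

theorem wt_mom {ι : Type*} [Fintype ι] [DecidableEq ι] (ρ v : ι → ℝ) (hρ : ∀ i, 0 < ρ i) :
    ∫ x in Set.pi Set.univ (fun i => Set.Icc (-ρ i) (ρ i)), (∑ i, v i * x i) ^ 2
      = (2 ^ Fintype.card ι * ∏ i, ρ i) * ((∑ i, v i ^ 2 * ρ i ^ 2) / 3) := by
  have hcomp : IsCompact (Set.pi Set.univ (fun i => Set.Icc (-ρ i) (ρ i))) :=
    isCompact_univ_pi fun i => isCompact_Icc
  have h1 : ∀ x : ι → ℝ, (∑ i, v i * x i) ^ 2 = ∑ i, ∑ j, v i * v j * (x i * x j) := by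
    intro x
    rw [sq, Finset.sum_mul_sum]
    exact Finset.sum_congr rfl fun i _ => Finset.sum_congr rfl fun j _ => by ring
  have hint : ∀ i j, ∫ x in Set.pi Set.univ (fun i => Set.Icc (-ρ i) (ρ i)), x i * x j
      = if i = j then (2 ^ Fintype.card ι * ∏ i, ρ i) * (ρ i ^ 2 / 3) else 0 := by
    intro i j
    rw [volume_pi, Measure.restrict_pi_pi]
    have hp : ∀ x : ι → ℝ, x i * x j =
        ∏ k, ((if k = i then x k else 1) * (if k = j then x k else 1)) := by
      intro x
      rw [Finset.prod_mul_distrib]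
      simp
    simp_rw [hp]
    rw [integral_fintype_prod_eq_prod
      (f := fun k (t : ℝ) => (if k = i then t else 1) * (if k = j then t else 1))]
    split_ifs with hij
    · subst hij
      have : ∀ k, (∫ t in Set.Icc (-ρ k) (ρ k),
          (if k = i then t else 1) * (if k = i then t else 1))
          = (2 * ρ k) * (if k = i then ρ k ^ 2 / 3 else 1) := by
        intro k
        rw [integral_Icc_eq_integral_Ioc,
          ← intervalIntegral.integral_of_le (by linarith [hρ k])]
        split_ifs with hk
        · simp_rw [← sq]
          rw [integral_pow]; push_cast; ring
        · simp; ring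
      simp_rw [this]
      rw [Finset.prod_mul_distrib, Finset.prod_mul_distrib]
      simp
    · apply Finset.prod_eq_zero (Finset.mem_univ i)
      rw [integral_Icc_eq_integral_Ioc,
          ← intervalIntegral.integral_of_le (by linarith [hρ i])]
      simp [hij]
  simp_rw [h1]
  have hI : ∀ i j, IntegrableOn (fun x : ι → ℝ => v i * v j * (x i * x j))
      (Set.pi Set.univ (fun i => Set.Icc (-ρ i) (ρ i))) := fun i j =>
    (Continuous.continuousOn (by fun_prop)).integrableOn_compact hcomp
  rw [integral_finsetSum _ (fun i _ => integrable_finsetSum _ fun j _ => hI i j)]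
  simp_rw [integral_finsetSum _ (fun j _ => hI _ j), integral_const_mul, hint]
  simp only [mul_ite, mul_zero, Finset.sum_ite_eq, Finset.mem_univ, if_true]
  rw [Finset.sum_div, Finset.mul_sum]
  exact Finset.sum_congr rfl fun i _ => by ring

theorem wt_slab {ι : Type*} [Fintype ι] [DecidableEq ι] (ρ v : ι → ℝ) (hρ : ∀ i, 0 < ρ i)
    (h : ∀ δ : ℝ, 0 < δ → volume (Set.pi Set.univ (fun i => Set.Icc (-ρ i) (ρ i)) ∩
      {x | |∑ i, v i * x i| < δ}) ≤ ENNReal.ofReal (2 ^ Fintype.card ι * δ)) :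
    (∏ i, ρ i) ^ 2 ≤ ∑ i, v i ^ 2 * ρ i ^ 2 := by
  set B := Set.pi Set.univ (fun i => Set.Icc (-ρ i) (ρ i)) with hB
  have hcomp : IsCompact B := isCompact_univ_pi fun i => isCompact_Icc
  have hBm : MeasurableSet B := hcomp.measurableSet
  set R := ∏ i, ρ i with hR
  have hRpos : 0 < R := Finset.prod_pos fun i _ => hρ i
  set N : ℝ := 2 ^ Fintype.card ι with hN
  have hNpos : 0 < N := by positivity
  have hvol : volume.real B = N * R := by
    rw [Measure.real, hB, volume_pi, Measure.pi_pi]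
    simp only [Real.volume_Icc, ENNReal.toReal_prod]
    rw [hN, hR, ← Finset.card_univ, ← Finset.prod_const, ← Finset.prod_mul_distrib]
    refine Finset.prod_congr rfl fun i _ => ?_
    rw [ENNReal.toReal_ofReal (by linarith [hρ i])]; ring
  set f : (ι → ℝ) → ℝ := fun x => max (R ^ 2 - (∑ i, v i * x i) ^ 2) 0 with hf
  have hfc : Continuous f := by fun_prop
  have hfi : Integrable f (volume.restrict B) := hfc.continuousOn.integrableOn_compact hcomp
  have hlay := hfi.integral_eq_integral_meas_lt (Filter.Eventually.of_forall fun x => le_max_right _ _)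
  have hlow : N * R * R ^ 2 - N * R * ((∑ i, v i ^ 2 * ρ i ^ 2) / 3) ≤ ∫ x in B, f x := by
    rw [← wt_mom ρ v hρ, ← hB, ← hvol, ← smul_eq_mul, ← setIntegral_const, ← integral_sub]
    · refine integral_mono ?_ hfi fun x => le_max_left _ _
      exact (Continuous.continuousOn (by fun_prop)).integrableOn_compact hcomp
    · exact (Continuous.continuousOn (by fun_prop)).integrableOn_compact hcomp
    · exact (Continuous.continuousOn (by fun_prop)).integrableOn_compact hcomp
  have hsq : ∫ t in (0 : ℝ)..(R ^ 2), √(R ^ 2 - t) = 2 / 3 * R ^ 3 := by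
    rw [intervalIntegral.integral_comp_sub_left (fun t => √t)]
    simp_rw [Real.sqrt_eq_rpow]
    rw [integral_rpow (by left; norm_num)]
    simp only [sub_self, sub_zero]
    rw [Real.zero_rpow (by norm_num), ← Real.rpow_natCast R 2, ← Real.rpow_mul hRpos.le]
    rw [show ((2 : ℕ) : ℝ) * (1 / 2 + 1) = ((3 : ℕ) : ℝ) by norm_num, Real.rpow_natCast]
    ring
  have hup : ∫ t in Set.Ioi (0 : ℝ), (volume.restrict B).real {a | t < f a} ≤
      N * (2 / 3 * R ^ 3) := by
    have hz : ∀ t ∈ Set.Ioi (0 : ℝ), (volume.restrict B).real {a | t < f a} ≤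
        (Set.Ioc 0 (R ^ 2)).indicator (fun t => N * √(R ^ 2 - t)) t := by
      intro t ht
      have ht0 : (0 : ℝ) < t := ht
      by_cases htR : t < R ^ 2
      · rw [Set.indicator_of_mem (show t ∈ Set.Ioc 0 (R ^ 2) from ⟨ht0, htR.le⟩)]
        have hδ : 0 < √(R ^ 2 - t) := Real.sqrt_pos.2 (by linarith)
        rw [Measure.real]
        apply ENNReal.toReal_le_of_le_ofReal (by positivity)
        refine le_trans ?_ (h _ hδ)
        rw [Measure.restrict_apply' hBm]
        apply measure_mono
        rintro x ⟨hx, hxB⟩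
        refine ⟨hxB, ?_⟩
        simp only [hf, Set.mem_ofPred_eq, lt_max_iff] at hx ⊢
        have : t < R ^ 2 - (∑ i, v i * x i) ^ 2 := by
          rcases hx with hx | hx
          · exact hx
          · linarith
        apply Real.lt_sqrt_of_sq_lt
        rw [sq_abs]; linarith
      · have : {a | t < f a} = ∅ := by
          ext x
          simp only [hf, Set.mem_ofPred_eq, lt_max_iff, Set.mem_empty_iff_false, iff_false]
          push Not
          exact ⟨by nlinarith [sq_nonneg (∑ i, v i * x i)], ht0.le⟩
        rw [this]
        simp only [measureReal_empty]
        exact Set.indicator_nonneg (fun t _ => by positivity) _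
    have hsub : Set.Ioc 0 (R ^ 2) ⊆ Set.Ioi (0 : ℝ) := fun t ht => ht.1
    calc _ ≤ ∫ t in Set.Ioi (0 : ℝ), (Set.Ioc 0 (R ^ 2)).indicator (fun t => N * √(R ^ 2 - t)) t := by
          refine integral_mono_of_nonneg (Filter.Eventually.of_forall fun t => measureReal_nonneg) ?_ ?_
          · refine Integrable.integrableOn ?_
            rw [integrable_indicator_iff measurableSet_Ioc]
            exact ((Continuous.continuousOn (by fun_prop)).integrableOn_compact
              (isCompact_Icc (a := (0 : ℝ)) (b := R ^ 2))).mono_set Set.Ioc_subset_Icc_self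
          · exact (ae_restrict_iff' measurableSet_Ioi).2 (Filter.Eventually.of_forall hz)
      _ = ∫ t in (0 : ℝ)..(R ^ 2), N * √(R ^ 2 - t) := by
          rw [setIntegral_indicator measurableSet_Ioc, Set.inter_eq_self_of_subset_right hsub,
            intervalIntegral.integral_of_le (by positivity)]
      _ = _ := by rw [intervalIntegral.integral_const_mul, hsq]
  have := hlow.trans (hlay.le.trans hup)
  have h2 : N * R * (R ^ 2 - (∑ i, v i ^ 2 * ρ i ^ 2)) ≤ 0 := by nlinarith
  have h3 : 0 < N * R := by positivity
  by_contra hcon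
  push Not at hcon
  have : 0 < N * R * (R ^ 2 - (∑ i, v i ^ 2 * ρ i ^ 2)) := mul_pos h3 (by linarith)
  linarith

theorem wt_mink {ι : Type*} [Fintype ι] [DecidableEq ι] (L : Matrix ι ι ℝ) (hL : L.det = 1)
    (z : ι → ℤ) (v ρ : ι → ℝ) (hv0 : v ≠ 0) (hρ : ∀ i, 0 < ρ i)
    (hz : ∀ x : ι → ℝ, ∑ i, v i * (L.mulVec x) i = ∑ i, z i * x i)
    (hlt : ∑ i, v i ^ 2 * ρ i ^ 2 < (∏ i, ρ i) ^ 2) :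
    ∃ k : ι → ℤ, k ≠ 0 ∧ ∀ i, |L.mulVec (fun j => (k j : ℝ)) i| ≤ ρ i := by
  have := mt (wt_slab ρ v hρ) (not_le.2 hlt)
  push Not at this
  obtain ⟨δ, hδ, hlt⟩ := this
  set B := Set.pi Set.univ (fun i => Set.Icc (-ρ i) (ρ i)) with hB
  have hvv : v ⬝ᵥ v ≠ 0 := fun h => hv0 (dotProduct_self_eq_zero.1 h)
  set u : ι → ℝ := ((δ - 1) / (v ⬝ᵥ v)) • v with hu
  have huv : v ⬝ᵥ u = δ - 1 := by
    rw [hu, dotProduct_smul, smul_eq_mul]; field_simp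
  set H : Matrix ι ι ℝ := 1 + Matrix.replicateCol Unit u * Matrix.replicateRow Unit v with hH
  have hHdet : H.det = δ := by
    rw [hH, Matrix.det_one_add_replicateCol_mul_replicateRow, huv]; ring
  have hHx : ∀ x, H.mulVec x = x + (v ⬝ᵥ x) • u := by
    intro x
    rw [hH, Matrix.add_mulVec, Matrix.one_mulVec, ← Matrix.mulVec_mulVec]
    congr 1
    ext i
    simp [Matrix.mulVec, dotProduct, Matrix.replicateCol, Matrix.replicateRow, mul_comm]
  have hHv : ∀ x, v ⬝ᵥ H.mulVec x = δ * (v ⬝ᵥ x) := by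
    intro x
    rw [hHx, dotProduct_add, dotProduct_smul, huv, smul_eq_mul]; ring
  set K := B ∩ {x | |∑ i, v i * x i| < δ} with hK
  set F := Matrix.toLin' (H * L) with hF
  have hFdet : LinearMap.det F = δ := by
    rw [hF, LinearMap.det_toLin', Matrix.det_mul, hHdet, hL, mul_one]
  have hvolF : (2 : ENNReal) ^ Fintype.card ι < volume (F ⁻¹' K) := by
    rw [Measure.addHaar_preimage_linearMap _ (by rw [hFdet]; exact hδ.ne'), hFdet]
    rw [abs_of_pos (inv_pos.2 hδ)]
    have e : (2 : ENNReal) ^ Fintype.card ι = ENNReal.ofReal δ⁻¹ *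
        ENNReal.ofReal (2 ^ Fintype.card ι * δ) := by
      rw [← ENNReal.ofReal_mul (inv_nonneg.2 hδ.le),
        show δ⁻¹ * (2 ^ Fintype.card ι * δ) = (2 : ℝ) ^ Fintype.card ι by field_simp,
        ENNReal.ofReal_pow (by norm_num)]
      simp
    rw [e]
    exact (ENNReal.mul_lt_mul_iff_right (by simpa using hδ) ENNReal.ofReal_ne_top).2 hlt
  have hKc : Convex ℝ K := by
    refine Convex.inter (convex_pi fun i _ => convex_Icc _ _) ?_
    have : {x : ι → ℝ | |∑ i, v i * x i| < δ} =
        (dotProductBilin ℝ ℝ v) ⁻¹' (Metric.ball (0 : ℝ) δ) := by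
      ext x; simp [dotProduct, Real.norm_eq_abs]
    rw [this]
    exact (convex_ball _ _).linear_preimage _
  have hKs : ∀ x ∈ K, -x ∈ K := by
    rintro x ⟨hx, hx2⟩
    refine ⟨fun i hi => ?_, ?_⟩
    · have := hx i hi
      simp only [Set.mem_Icc, Pi.neg_apply] at this ⊢
      constructor <;> linarith
    · simpa using hx2
  have fund := ZSpan.isAddFundamentalDomain' (Pi.basisFun ℝ ι) volume
  have : Countable (Submodule.span ℤ (Set.range (Pi.basisFun ℝ ι))).toAddSubgroup :=
    inferInstanceAs (Countable (Submodule.span ℤ (Set.range (Pi.basisFun ℝ ι))))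
  obtain ⟨⟨x, hxL⟩, hx0, hxK⟩ :=
    exists_ne_zero_mem_lattice_of_measure_mul_two_pow_lt_measure (s := F ⁻¹' K) fund
      (fun x hx => by simpa using hKs _ hx) (hKc.linear_preimage F) (by
        have hone : volume (ZSpan.fundamentalDomain (Pi.basisFun ℝ ι)) = 1 := by
          rw [ZSpan.fundamentalDomain_pi_basisFun, volume_pi, Measure.pi_pi]
          simp
        rw [hone, one_mul, Module.finrank_fintype_fun_eq_card]
        exact hvolF)
  have hk : ∀ i, ∃ k : ℤ, (k : ℝ) = x i := by
    intro i
    have := ((Pi.basisFun ℝ ι).mem_span_iff_repr_mem ℤ x).1 hxL i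
    simpa using this
  choose k hk using hk
  have hkx : (fun j => (k j : ℝ)) = x := funext hk
  have hFx : F x = H.mulVec (L.mulVec x) := by
    rw [hF, Matrix.toLin'_apply, Matrix.mulVec_mulVec]
  change F x ∈ K at hxK
  rw [hFx] at hxK
  have h0 : v ⬝ᵥ L.mulVec x = 0 := by
    have h1 : |v ⬝ᵥ H.mulVec (L.mulVec x)| < δ := hxK.2
    have h2 : v ⬝ᵥ L.mulVec x = ((∑ i, z i * k i : ℤ) : ℝ) := by
      have := hz x
      rw [dotProduct, this]; push_cast; simp_rw [hk]
    rw [hHv, abs_mul, abs_of_pos hδ, h2, ← Int.cast_abs] at h1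
    have h3 : ((|∑ i, z i * k i| : ℤ) : ℝ) < 1 := by
      by_contra hc
      push Not at hc
      nlinarith
    have h4 : |∑ i, z i * k i| < 1 := by exact_mod_cast h3
    rw [h2, Int.abs_lt_one_iff.1 h4]; simp
  rw [hHx, h0, zero_smul, add_zero] at hxK
  refine ⟨k, ?_, ?_⟩
  · rintro rfl
    apply hx0
    ext i
    have := hk i
    simp at this
    simp [← this]
  · intro i
    rw [hkx]
    exact abs_le.2 (hxK.1 i (Set.mem_univ i))

theorem wt_closed {ι : Type*} [Fintype ι] [DecidableEq ι] (L : Matrix ι ι ℝ) (hL : L.det = 1)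
    (hcard : 2 ≤ Fintype.card ι)
    (z : ι → ℤ) (v η : ι → ℝ) (hv0 : v ≠ 0) (hη : ∀ i, 0 < η i)
    (hz : ∀ x : ι → ℝ, ∑ i, v i * (L.mulVec x) i = ∑ i, z i * x i)
    (hvη : ∀ i, |v i| ≤ η i) (lam : ℝ) (hlam : 0 < lam)
    (hl : lam ^ (Fintype.card ι - 1) = √(Fintype.card ι) * ∏ i, η i) :
    ∃ k : ι → ℤ, k ≠ 0 ∧ ∀ i, |L.mulVec (fun j => (k j : ℝ)) i| ≤ lam / η i := by
  have key : ∀ l > lam, ∃ k : ι → ℤ, k ≠ 0 ∧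
      ∀ i, |L.mulVec (fun j => (k j : ℝ)) i| ≤ l / η i := by
    intro l hll
    have hl0 : 0 < l := hlam.trans hll
    refine wt_mink L hL z v (fun i => l / η i) hv0 (fun i => div_pos hl0 (hη i)) hz ?_
    have hP : 0 < ∏ i, η i := Finset.prod_pos fun i _ => hη i
    have h1 : ∑ i, v i ^ 2 * (l / η i) ^ 2 ≤ Fintype.card ι * l ^ 2 := by
      rw [← Finset.card_univ, ← nsmul_eq_mul]
      refine Finset.sum_le_card_nsmul _ _ _ fun i _ => ?_
      have : v i ^ 2 ≤ η i ^ 2 := sq_le_sq' (by linarith [neg_abs_le (v i), hvη i])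
        ((le_abs_self _).trans (hvη i))
      rw [div_pow, mul_div_assoc', div_le_iff₀ (pow_pos (hη i) 2), mul_comm]
      gcongr
    refine h1.trans_lt ?_
    rw [Finset.prod_div_distrib, Finset.prod_const, Finset.card_univ]
    have h2 : √(Fintype.card ι) * l < l ^ Fintype.card ι / ∏ i, η i := by
      rw [lt_div_iff₀ hP]
      have : lam ^ (Fintype.card ι - 1) < l ^ (Fintype.card ι - 1) :=
        pow_lt_pow_left₀ hll hlam.le (by omega)
      calc √(Fintype.card ι) * l * ∏ i, η i = lam ^ (Fintype.card ι - 1) * l := by rw [hl]; ring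
        _ < l ^ (Fintype.card ι - 1) * l := by gcongr
        _ = l ^ Fintype.card ι := by rw [← pow_succ]; congr 1; omega
    have h3 : (Fintype.card ι : ℝ) * l ^ 2 = (√(Fintype.card ι) * l) ^ 2 := by
      rw [mul_pow, Real.sq_sqrt (by positivity)]
    rw [h3]
    gcongr
  by_contra hcon
  push Not at hcon
  have hLu : IsUnit L.det := by rw [hL]; exact isUnit_one
  set S : Set (ι → ℤ) := {k | ∀ i, |L.mulVec (fun j => (k j : ℝ)) i| ≤ (lam + 1) / η i} with hS
  have hfin : S.Finite := by
    set C : ι → ℝ := fun i => ∑ j, |L⁻¹ i j| * ((lam + 1) / η j) with hC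
    refine (Set.Finite.pi' (fun i => Set.finite_Icc (-⌈C i⌉) ⌈C i⌉)).subset ?_
    intro k hk i
    have e : (k i : ℝ) = ∑ j, L⁻¹ i j * L.mulVec (fun j => (k j : ℝ)) j := by
      have : L⁻¹.mulVec (L.mulVec (fun j => (k j : ℝ))) = (fun j => (k j : ℝ)) := by
        rw [Matrix.mulVec_mulVec, Matrix.nonsing_inv_mul _ hLu, Matrix.one_mulVec]
      exact (congrFun this i).symm
    have h1 : |(k i : ℝ)| ≤ C i := by
      rw [e]
      refine (Finset.abs_sum_le_sum_abs _ _).trans (Finset.sum_le_sum fun j _ => ?_)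
      rw [abs_mul]
      exact mul_le_mul_of_nonneg_left (hk j) (abs_nonneg _)
    have h2 : |k i| ≤ ⌈C i⌉ := by
      have := h1.trans (Int.le_ceil (C i))
      exact_mod_cast this
    exact abs_le.1 h2
  have hev : ∀ᶠ l in nhdsWithin lam (Set.Ioi lam), ∀ k ∈ S, k ≠ 0 →
      ∃ i, l / η i < |L.mulVec (fun j => (k j : ℝ)) i| := by
    rw [Filter.eventually_all_finite hfin]
    intro k _
    by_cases hk0 : k = 0
    · simp [hk0]
    · obtain ⟨i, hi⟩ := hcon k hk0
      have ht : Filter.Tendsto (fun l => l / η i) (nhdsWithin lam (Set.Ioi lam))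
          (nhds (lam / η i)) :=
        (Continuous.tendsto (by fun_prop) lam).mono_left nhdsWithin_le_nhds
      filter_upwards [ht.eventually_lt_const hi] with l hl _
      exact ⟨i, hl⟩
  have hev2 : ∀ᶠ l in nhdsWithin lam (Set.Ioi lam), l ∈ Set.Ioc lam (lam + 1) :=
    Ioc_mem_nhdsGT (by linarith)
  obtain ⟨l, h1, h2⟩ := (hev.and hev2).exists
  obtain ⟨k, hk0, hk⟩ := key l h2.1
  have hkS : k ∈ S := fun i => (hk i).trans (by have := hη i; have := h2.2; gcongr)
  obtain ⟨i, hi⟩ := h1 k hkS hk0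
  exact absurd (hk i) (not_le.2 hi)

end Helpers

theorem wt_qnorm {k : ℕ} (hk : 0 < k) (w x : Fin k → ℝ) (hw : ∀ i, 0 < w i) (X : ℝ)
    (hX : 0 ≤ X) : qnorm hk w x ≤ X ↔ ∀ i, |x i| ≤ X ^ w i := by
  unfold qnorm
  rw [Finset.sup'_le_iff]
  simp only [Finset.mem_univ, true_implies]
  exact forall_congr' fun i => Real.rpow_inv_le_iff_of_pos (abs_nonneg _) hX (hw i)

theorem wt_qnorm_nonneg {k : ℕ} (hk : 0 < k) (w x : Fin k → ℝ) : 0 ≤ qnorm hk w x := by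
  unfold qnorm
  refine le_trans ?_ (Finset.le_sup' (fun i => |x i| ^ (w i)⁻¹) (Finset.mem_univ ⟨0, hk⟩))
  positivity

theorem wt_idist {k : ℕ} (hk : 0 < k) (w x : Fin k → ℝ) (hw : ∀ i, 0 < w i) (X : ℝ)
    (hX : 0 ≤ X) : idist hk w x ≤ X ↔ ∃ p : Fin k → ℤ, ∀ i, |x i - p i| ≤ X ^ w i := by
  constructor
  · intro h
    refine ⟨fun i => round (x i), ?_⟩
    rw [← wt_qnorm hk w (fun i => x i - (round (x i) : ℝ)) hw X hX]
    refine le_trans (le_ciInf fun p => ?_) h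
    rw [wt_qnorm hk w _ hw _ (wt_qnorm_nonneg hk w _)]
    intro i
    exact (round_le (x i) (p i)).trans
      ((wt_qnorm hk w _ hw _ (wt_qnorm_nonneg hk w (fun i => x i - (p i : ℝ)))).1 le_rfl i)
  · rintro ⟨p, hp⟩
    refine (ciInf_le ⟨0, ?_⟩ p).trans ((wt_qnorm hk w (fun i => x i - (p i : ℝ)) hw X hX).2 hp)
    rintro _ ⟨p, rfl⟩
    exact wt_qnorm_nonneg hk w _

/-- Weighted transference principle: a good solution for `A` up to time `T` yields a
good solution for `A^T` up to time `T₁ = c^{1/r_m} ε^{−r_m(1−s_n)/(s_n+r_1(1−s_n))} T`. -/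
theorem weighted_transference {m n : ℕ} (hm : 0 < m) (hn : 0 < n)
    (r : Fin m → ℝ) (s : Fin n → ℝ)
    (hrpos : ∀ i, 0 < r i) (hspos : ∀ j, 0 < s j)
    (hrmono : ∀ i i' : Fin m, i ≤ i' → r i' ≤ r i)
    (hsmono : ∀ j j' : Fin n, j ≤ j' → s j' ≤ s j)
    (hrsum : ∑ i, r i = 1) (hssum : ∑ j, s j = 1)
    (A : Matrix (Fin m) (Fin n) ℝ) (ε : ℝ) (hε0 : 0 < ε) (hε1 : ε < 1)
    (rm sn r1 c : ℝ)
    (hrm : rm = r ⟨m - 1, by omega⟩) (hsn : sn = s ⟨n - 1, by omega⟩)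
    (hr1 : r1 = r ⟨0, hm⟩)
    (hc : c = ((m + n : ℕ) : ℝ) ^ (1 / (2 * (((m + n : ℕ) : ℝ) - 1)))) :
    ∃ T₀ : ℝ, 1 ≤ T₀ ∧ ∀ T : ℝ, T₀ ≤ T →
      (∃ q : Fin n → ℤ, q ≠ 0 ∧
          idist hm r (fun i => ∑ j, A i j * (q j : ℝ)) ≤ ε * T⁻¹ ∧
          qnorm hn s (fun j => (q j : ℝ)) ≤ T) →
      ∃ y : Fin m → ℤ, y ≠ 0 ∧
        idist hn s (fun jj => ∑ i, A i jj * (y i : ℝ)) ≤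
          c ^ (rm⁻¹ + sn⁻¹) * ε ^ (rm * sn / (sn + r1 * (1 - sn))) *
            (c ^ rm⁻¹ * ε ^ (-(rm * (1 - sn)) / (sn + r1 * (1 - sn))) * T)⁻¹ ∧
        qnorm hm r (fun i => (y i : ℝ)) ≤
          c ^ rm⁻¹ * ε ^ (-(rm * (1 - sn)) / (sn + r1 * (1 - sn))) * T := by
  have hrm0 : 0 < rm := hrm ▸ hrpos _
  have hsn0 : 0 < sn := hsn ▸ hspos _
  have hr10 : 0 < r1 := hr1 ▸ hrpos _
  have hrmle : ∀ i, rm ≤ r i := fun i => by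
    rw [hrm]; exact hrmono _ _ (by rw [Fin.le_def]; simp; omega)
  have hsnle : ∀ j, sn ≤ s j := fun j => by
    rw [hsn]; exact hsmono _ _ (by rw [Fin.le_def]; simp; omega)
  have hrmr1 : rm ≤ r1 := by rw [hr1]; exact hrmle _
  have hsn1 : sn ≤ 1 := by
    rw [← hssum]
    exact (hsnle ⟨0, hn⟩).trans (Finset.single_le_sum (fun j _ => (hspos j).le) (Finset.mem_univ _))
  set D := sn + r1 * (1 - sn) with hD
  have hD0 : 0 < D := by
    have : 0 ≤ r1 * (1 - sn) := mul_nonneg hr10.le (by linarith)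
    linarith
  set d : ℕ := m + n with hd
  have hd2 : 2 ≤ d := by omega
  have hd1 : (1 : ℝ) ≤ (d : ℝ) - 1 := by
    have : (2 : ℝ) ≤ d := by exact_mod_cast hd2
    linarith
  have hc1 : 1 ≤ c := by
    rw [hc]
    exact Real.one_le_rpow (by linarith) (by positivity)
  have hc0 : 0 < c := by linarith
  have hcd : c ^ (d - 1) = √(d : ℝ) := by
    rw [hc, ← Real.rpow_natCast, ← Real.rpow_mul (by positivity), Real.sqrt_eq_rpow,
      Nat.cast_sub (by omega)]
    congr 1
    push_cast
    field_simp
  refine ⟨c ^ sn⁻¹ + 1, by have := Real.rpow_nonneg hc0.le sn⁻¹; linarith, ?_⟩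
  rintro T hT ⟨q, hq0, hq1, hq2⟩
  have hcs1 : 1 ≤ c ^ sn⁻¹ := Real.one_le_rpow hc1 (by positivity)
  have hT1 : 1 ≤ T := by linarith
  have hT0 : 0 < T := by linarith
  have hcT : c < T ^ sn := by
    have : c ^ sn⁻¹ < T := by linarith
    exact (Real.rpow_inv_lt_iff_of_pos hc0.le hT0.le hsn0).1 this
  rw [wt_idist hm r _ hrpos _ (by positivity)] at hq1
  rw [wt_qnorm hn s _ hspos _ hT0.le] at hq2
  obtain ⟨p, hp⟩ := hq1
  set S := rm * sn / D with hS
  set E := rm * (1 - sn) / D with hE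
  have hSE : S + E = rm / D := by rw [hS, hE, ← add_div]; ring_nf
  have hE0 : 0 ≤ E := div_nonneg (mul_nonneg hrm0.le (by linarith)) hD0.le
  have hneg : -(rm * (1 - sn)) / D = -E := by rw [hE]; ring
  rw [hneg]
  have hx1 : c ^ (rm⁻¹ + sn⁻¹) * ε ^ S * (c ^ rm⁻¹ * ε ^ (-E) * T)⁻¹
      = c ^ sn⁻¹ * (ε ^ (rm / D) * T⁻¹) := by
    rw [← hSE, Real.rpow_add hc0, Real.rpow_add hε0, Real.rpow_neg hε0.le]
    have := Real.rpow_pos_of_pos hc0 rm⁻¹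
    have := Real.rpow_pos_of_pos hε0 E
    field_simp
  rw [hx1]
  set a : Fin m → ℝ := fun i => S + r i * E with ha
  set b : Fin n → ℝ := fun j => S - s j * (rm / D) with hb
  set η : Fin m ⊕ Fin n → ℝ := Sum.elim (fun i => ε ^ a i * T ^ (-r i))
    (fun j => ε ^ b j * T ^ s j) with hη
  have hη0 : ∀ i, 0 < η i := by
    rintro (i | j) <;> simp only [hη, Sum.elim_inl, Sum.elim_inr] <;> positivity
  have haler : ∀ i, a i ≤ r i := by
    intro i
    have h1 : a i = (rm * sn + r i * (rm * (1 - sn))) / D := by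
      simp only [ha, hS, hE]; ring
    rw [h1, div_le_iff₀ hD0, hD]
    have h2 : rm * sn ≤ r i * sn := mul_le_mul_of_nonneg_right (hrmle i) hsn0.le
    have h3 : r i * (rm * (1 - sn)) ≤ r i * (r1 * (1 - sn)) :=
      mul_le_mul_of_nonneg_left (mul_le_mul_of_nonneg_right hrmr1 (by linarith)) (hrpos i).le
    linarith
  have hble : ∀ j, b j ≤ 0 := by
    intro j
    have : S = sn * (rm / D) := by rw [hS]; ring
    simp only [hb, this]
    have := mul_le_mul_of_nonneg_right (hsnle j) (div_pos hrm0 hD0).le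
    linarith
  set L : Matrix (Fin m ⊕ Fin n) (Fin m ⊕ Fin n) ℝ := Matrix.fromBlocks 1 0 A.transpose 1 with hL
  have hLdet : L.det = 1 := by rw [hL, Matrix.det_fromBlocks_zero₁₂]; simp
  set z : Fin m ⊕ Fin n → ℤ := Sum.elim p q with hz
  set v : Fin m ⊕ Fin n → ℝ := Sum.elim (fun i => (p i : ℝ) - ∑ j, A i j * (q j : ℝ))
    (fun j => (q j : ℝ)) with hv
  have hL1 : ∀ x i, L.mulVec x (Sum.inl i) = x (Sum.inl i) := by
    intro x i
    simp [hL, Matrix.fromBlocks_mulVec]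
  have hL2 : ∀ x j, L.mulVec x (Sum.inr j) = ∑ i, A i j * x (Sum.inl i) + x (Sum.inr j) := by
    intro x j
    simp [hL, Matrix.mulVec, dotProduct, Matrix.one_apply]
  have hv0 : v ≠ 0 := by
    intro h
    apply hq0
    ext j
    have := congrFun h (Sum.inr j)
    simpa [hv] using this
  have hzv : ∀ x : Fin m ⊕ Fin n → ℝ, ∑ i, v i * (L.mulVec x) i = ∑ i, z i * x i := by
    intro x
    rw [Fintype.sum_sum_type, Fintype.sum_sum_type]
    simp only [hL1, hL2, hv, hz, Sum.elim_inl, Sum.elim_inr]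
    simp only [sub_mul, mul_add, Finset.sum_sub_distrib, Finset.sum_add_distrib]
    have : ∑ i, (∑ j, A i j * (q j : ℝ)) * x (Sum.inl i)
        = ∑ j, (q j : ℝ) * ∑ i, A i j * x (Sum.inl i) := by
      simp only [Finset.sum_mul, Finset.mul_sum]
      rw [Finset.sum_comm]
      exact Finset.sum_congr rfl fun j _ => Finset.sum_congr rfl fun i _ => by ring
    rw [this]; ring
  have hvη : ∀ i, |v i| ≤ η i := by
    rintro (i | j)
    · simp only [hv, hη, Sum.elim_inl]
      rw [abs_sub_comm]
      refine (hp i).trans ?_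
      rw [Real.mul_rpow hε0.le (inv_nonneg.2 hT0.le), Real.inv_rpow hT0.le, ← Real.rpow_neg hT0.le]
      exact mul_le_mul_of_nonneg_right
        (Real.rpow_le_rpow_of_exponent_ge hε0 hε1.le (haler i)) (by positivity)
    · simp only [hv, hη, Sum.elim_inr]
      refine (hq2 j).trans ?_
      have : 1 ≤ ε ^ b j := Real.one_le_rpow_of_pos_of_le_one_of_nonpos hε0 hε1.le (hble j)
      exact le_mul_of_one_le_left (by positivity) this
  have hcard : Fintype.card (Fin m ⊕ Fin n) = d := by simp [hd]
  have hprod : ∏ i, η i = (ε ^ S) ^ (d - 1) := by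
    rw [Fintype.prod_sum_type]
    simp only [hη, Sum.elim_inl, Sum.elim_inr, Finset.prod_mul_distrib]
    rw [← Real.rpow_sum_of_pos hε0, ← Real.rpow_sum_of_pos hε0, ← Real.rpow_sum_of_pos hT0,
      ← Real.rpow_sum_of_pos hT0, hssum, Finset.sum_neg_distrib, hrsum]
    have h1 : ∑ i, a i = m * S + E := by
      simp only [ha, Finset.sum_add_distrib, ← Finset.sum_mul, hrsum]; simp
    have h2 : ∑ j, b j = n * S - (S + E) := by
      simp only [hb, Finset.sum_sub_distrib, ← Finset.sum_mul, hssum, hSE]; simp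
    rw [h1, h2, ← Real.rpow_natCast, ← Real.rpow_mul hε0.le, Nat.cast_sub (by omega)]
    have h3 : ε ^ (m * S + E) * T ^ (-1 : ℝ) * (ε ^ (n * S - (S + E)) * T ^ (1 : ℝ))
        = (ε ^ (m * S + E) * ε ^ (n * S - (S + E))) * (T ^ (-1 : ℝ) * T ^ (1 : ℝ)) := by ring
    rw [h3, ← Real.rpow_add hε0, ← Real.rpow_add hT0]
    simp only [neg_add_cancel, Real.rpow_zero, mul_one]
    congr 1
    rw [hd]; push_cast; ring
  obtain ⟨k, hk0, hk⟩ := wt_closed L hLdet (by rw [hcard]; exact hd2) z v η hv0 hη0 hzv hvη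
    (c * ε ^ S) (by positivity) (by rw [hcard, mul_pow, hcd, hprod])
  have hk1 : ∀ i, |(k (Sum.inl i) : ℝ)| ≤ c * (ε ^ (-E) * T) ^ r i := by
    intro i
    have := hk (Sum.inl i)
    rw [hL1] at this
    refine this.trans_eq ?_
    simp only [hη, Sum.elim_inl, ha]
    rw [Real.mul_rpow (by positivity) hT0.le, ← Real.rpow_mul hε0.le, Real.rpow_neg hT0.le,
      Real.rpow_add hε0, show -E * r i = -(r i * E) by ring, Real.rpow_neg hε0.le]
    field_simp
  have hk2 : ∀ j, |∑ i, A i j * (k (Sum.inl i) : ℝ) + (k (Sum.inr j) : ℝ)| ≤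
      c * (ε ^ (rm / D) * T⁻¹) ^ s j := by
    intro j
    have := hk (Sum.inr j)
    rw [hL2] at this
    refine this.trans_eq ?_
    simp only [hη, Sum.elim_inr, hb]
    rw [Real.mul_rpow (by positivity) (by positivity), ← Real.rpow_mul hε0.le, Real.inv_rpow hT0.le,
      Real.rpow_sub hε0, mul_comm (rm / D)]
    field_simp
  refine ⟨fun i => k (Sum.inl i), ?_, ?_, ?_⟩
  · intro h0
    have h0' : ∀ i, k (Sum.inl i) = 0 := fun i => congrFun h0 i
    apply hk0
    ext (i | j)
    · exact h0' i
    · have h1 := hk2 j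
      simp only [h0', Int.cast_zero, mul_zero, Finset.sum_const_zero, zero_add] at h1
      have h2 : c * (ε ^ (rm / D) * T⁻¹) ^ s j < 1 := by
        rw [Real.mul_rpow (by positivity) (by positivity), Real.inv_rpow hT0.le]
        have h3 : (ε ^ (rm / D)) ^ s j ≤ 1 :=
          Real.rpow_le_one (by positivity)
            (Real.rpow_le_one hε0.le hε1.le (div_pos hrm0 hD0).le) (hspos j).le
        have h4 : c < T ^ s j := hcT.trans_le (Real.rpow_le_rpow_of_exponent_le hT1 (hsnle j))
        have h5 : 0 < T ^ s j := hc0.trans h4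
        calc c * ((ε ^ (rm / D)) ^ s j * (T ^ s j)⁻¹) ≤ c * (1 * (T ^ s j)⁻¹) := by gcongr
          _ < 1 := by rw [one_mul, ← div_eq_mul_inv, div_lt_one h5]; exact h4
      have h6 : |k (Sum.inr j)| < 1 := by
        have := h1.trans_lt h2
        exact_mod_cast this
      exact Int.abs_lt_one_iff.1 h6
  · rw [wt_idist hn s _ hspos _ (by positivity)]
    refine ⟨fun j => - k (Sum.inr j), fun j => ?_⟩
    have h1 := hk2 j
    push_cast
    rw [sub_neg_eq_add]
    refine h1.trans ?_
    rw [Real.mul_rpow (x := c ^ sn⁻¹) (by positivity) (by positivity)]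
    refine mul_le_mul_of_nonneg_right ?_ (by positivity)
    rw [← Real.rpow_mul hc0.le]
    apply Real.self_le_rpow_of_one_le hc1
    rw [inv_mul_eq_div, one_le_div hsn0]
    exact hsnle j
  · rw [wt_qnorm hm r _ hrpos _ (by positivity)]
    intro i
    refine (hk1 i).trans ?_
    rw [mul_assoc, Real.mul_rpow (x := c ^ rm⁻¹) (by positivity) (by positivity)]
    refine mul_le_mul_of_nonneg_right ?_ (by positivity)
    rw [← Real.rpow_mul hc0.le]
    apply Real.self_le_rpow_of_one_le hc1
    rw [inv_mul_eq_div, one_le_div hrm0]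
    exact hrmle i
end
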